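/- arXiv:2209.13343 — 2 statements merged into one kernel-verified Lean document; each statement's English description precedes it below -/
import Mathlib

section
/- Let G be a 2-step nilpotent subgroup of UT(n,ℚ), let 𝒢 = {A_1,...,A_K} ⊆ G, and let w be a word over 𝒢 with Parikh image (ℓ_1,...,ℓ_K). Then the logarithm of the product of the matrices of w in order equals Σ_{i=1}^K ℓ_i log A_i + (1/2) Σ_{1 ≤ i < j ≤ K} δ_ij(w) [log A_i, log A_j]. -/
/-- Upper unitriangular rational matrix: ones on the diagonal, zeros below. -/
def IsUnitriangular {n : ℕ} (A : Matrix (Fin n) (Fin n) ℚ) : Prop :=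
  (∀ i, A i i = 1) ∧ ∀ i j : Fin n, j < i → A i j = 0

/-- Strictly upper triangular rational matrix: zeros on and below the diagonal. -/
def IsStrictUpper {n : ℕ} (X : Matrix (Fin n) (Fin n) ℚ) : Prop :=
  ∀ i j : Fin n, j ≤ i → X i j = 0

/-- Matrix logarithm on unitriangular matrices (a finite sum). -/
def mlog {n : ℕ} (A : Matrix (Fin n) (Fin n) ℚ) : Matrix (Fin n) (Fin n) ℚ :=
  ∑ k ∈ Finset.Icc 1 n, ((-1 : ℚ) ^ (k - 1) / (k : ℚ)) • (A - 1) ^ k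

/-- Matrix exponential on strictly upper triangular matrices (a finite sum). -/
def mexp {n : ℕ} (X : Matrix (Fin n) (Fin n) ℚ) : Matrix (Fin n) (Fin n) ℚ :=
  ∑ k ∈ Finset.range (n + 1), ((k.factorial : ℚ))⁻¹ • X ^ k

/-- Commutator bracket [X, Y] = XY − YX. -/
def mcomm {n : ℕ} (X Y : Matrix (Fin n) (Fin n) ℚ) : Matrix (Fin n) (Fin n) ℚ :=
  X * Y - Y * X

def delta {α : Type*} [DecidableEq α] (i j : α) : List α → ℤ
  | [] => 0
  | a :: w => delta i j w + (if a = i then (w.count j : ℤ) else 0)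
      - (if a = j then (w.count i : ℤ) else 0)

section Aux
open Polynomial

variable {R : Type*} [Ring R] [Algebra ℚ R]

theorem aux_deriv_pow (P : R[X]) (h : Commute P (derivative P)) (i : ℕ) :
    derivative (P ^ (i + 1)) = ((i : ℚ) + 1) • (P ^ i * derivative P) := by
  induction i with
  | zero => simp
  | succ i ih =>
    have h2 : P ^ i * derivative P * P = P ^ (i + 1) * derivative P := by
      rw [mul_assoc, ← h.eq, ← mul_assoc, ← pow_succ]
    rw [pow_succ P (i + 1), derivative_mul, ih, smul_mul_assoc, h2]
    push_cast
    module

theorem aux_deriv_exp (P : R[X]) (h : Commute P (derivative P)) (hP : IsNilpotent P) :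
    derivative (IsNilpotent.exp P) = IsNilpotent.exp P * derivative P := by
  obtain ⟨k, hk⟩ := hP
  have hk1 : P ^ (k + 1) = 0 := by rw [pow_succ, hk, zero_mul]
  conv_lhs => rw [IsNilpotent.exp_eq_sum hk1]
  rw [IsNilpotent.exp_eq_sum hk, Finset.sum_range_succ', Finset.sum_mul]
  simp only [map_add, map_sum, derivative_smul, aux_deriv_pow P h, pow_zero, derivative_one,
    smul_zero, add_zero, smul_smul, smul_mul_assoc]
  refine Finset.sum_congr rfl fun i _ => ?_
  congr 1
  rw [Nat.factorial_succ]
  have : (i.factorial : ℚ) ≠ 0 := by positivity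
  have h3 : (i : ℚ) + 1 ≠ 0 := by positivity
  push_cast
  field_simp

/-- evaluation at a rational point (central). -/
noncomputable def evq (q : ℚ) : R[X] →+* R :=
  eval₂RingHom' (RingHom.id R) (algebraMap ℚ R q) (fun a => (Algebra.commutes q a).symm)

theorem evq_C (q : ℚ) (a : R) : evq q (C a) = a := by
  change eval₂ (RingHom.id R) _ (C a) = a
  rw [eval₂_C]; rfl

theorem evq_X (q : ℚ) : evq q (X : R[X]) = algebraMap ℚ R q := by
  change eval₂ (RingHom.id R) _ X = _
  rw [eval₂_X]

theorem aux_const (P : R[X]) (h : derivative P = 0) : evq 1 P = evq 0 P := by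
  have : P = C (P.coeff 0) := by
    ext m
    rcases m with _ | m
    · simp
    · have h1 : (derivative P).coeff m = 0 := by rw [h]; simp
      rw [coeff_derivative] at h1
      have h2 : ((m : ℚ) + 1) • P.coeff (m + 1) = 0 := by
        rw [Algebra.smul_def, Algebra.commutes]
        simpa using h1
      have h3 : (m : ℚ) + 1 ≠ 0 := by positivity
      rw [coeff_C_succ]
      exact (smul_eq_zero_iff_right h3).1 h2
  rw [this, evq_C, evq_C]

theorem aux_mul_exp {S : Type*} [Ring S] [Algebra ℚ S] (a b c : S) (h : a * b = b * a + c)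
    (hc : Commute c b) (hb : IsNilpotent b) :
    a * IsNilpotent.exp b = IsNilpotent.exp b * (a + c) := by
  have key : ∀ i : ℕ, a * b ^ (i + 1) = b ^ (i + 1) * a + ((i : ℚ) + 1) • (b ^ i * c) := by
    intro i
    induction i with
    | zero => simp [h]
    | succ i ih =>
      have h2 : b ^ i * c * b = b ^ (i + 1) * c := by
        rw [mul_assoc, hc.eq, ← mul_assoc, ← pow_succ]
      rw [pow_succ b (i + 1), ← mul_assoc, ih, add_mul, mul_assoc, h, smul_mul_assoc, h2]
      push_cast
      rw [mul_add, ← mul_assoc]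
      module
  obtain ⟨k, hk⟩ := hb
  have hk1 : b ^ (k + 1) = 0 := by rw [pow_succ, hk, zero_mul]
  rw [mul_add]
  conv_lhs => rw [IsNilpotent.exp_eq_sum hk1]
  conv_rhs => enter [1]; rw [IsNilpotent.exp_eq_sum hk1]
  conv_rhs => enter [2]; rw [IsNilpotent.exp_eq_sum hk]
  rw [Finset.sum_range_succ', mul_add, add_mul, Finset.mul_sum, Finset.sum_mul, Finset.sum_mul,
    add_right_comm, ← Finset.sum_add_distrib]
  simp only [pow_zero, mul_smul_comm, smul_mul_assoc, mul_one, one_mul, key]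
  congr 1
  refine Finset.sum_congr rfl fun i _ => ?_
  rw [smul_add, smul_smul]
  congr 2
  rw [Nat.factorial_succ]
  have : (i.factorial : ℚ) ≠ 0 := by positivity
  have h3 : (i : ℚ) + 1 ≠ 0 := by positivity
  push_cast
  field_simp

theorem aux_nil_CX (a : R) (ha : IsNilpotent a) (m : ℕ) : IsNilpotent (C a * X ^ m : R[X]) := by
  have h1 : IsNilpotent (C a : R[X]) := ha.map (C : R →+* R[X])
  exact Commute.isNilpotent_mul_right (commute_X_pow _ _).symm h1

theorem aux_bch (x y c : R) (hc : x * y - y * x = c) (hcx : Commute c x) (hcy : Commute c y)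
    (hx : IsNilpotent x) (hy : IsNilpotent y) (hxy : IsNilpotent (x + y)) (hcn : IsNilpotent c) :
    IsNilpotent.exp x * IsNilpotent.exp y = IsNilpotent.exp (x + y + (1 / 2 : ℚ) • c) := by
  set a : R[X] := C x * X with ha
  set b : R[X] := C y * X with hb
  set P : R[X] := C (x + y) * X + C ((1 / 2 : ℚ) • c) * X ^ 2 with hP
  have na : IsNilpotent a := by
    have := aux_nil_CX x hx 1
    rwa [pow_one] at this
  have nb : IsNilpotent b := by
    have := aux_nil_CX y hy 1
    rwa [pow_one] at this
  have cc : Commute (x + y) c := (hcx.add_right hcy).symm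
  have comm1 : ∀ (u v : R) (i j : ℕ), Commute u v →
      Commute (C u * X ^ i : R[X]) (C v * X ^ j) := by
    intro u v i j h
    have h1 : Commute (C u : R[X]) (C v) := h.map (C : R →+* R[X])
    exact (h1.mul_right (commute_X_pow _ _).symm).mul_left
      (commute_X_pow _ _)
  have nP : IsNilpotent P := by
    refine Commute.isNilpotent_add ?_ (by simpa using aux_nil_CX _ hxy 1)
      (aux_nil_CX _ (hcn.smul _) 2)
    simpa using comm1 (x + y) ((1 / 2 : ℚ) • c) 1 2 (cc.smul_right _)
  have dP : derivative P = C (x + y) + C c * X := by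
    simp only [hP, map_add, derivative_mul, derivative_C, derivative_X, derivative_X_pow]
    have : (C ((1 / 2 : ℚ) • c) * C 2 : R[X]) = C c := by
      rw [← C_mul, mul_two, ← add_smul]
      norm_num
    simp only [zero_mul, zero_add, mul_one, ← mul_assoc]
    simp
    congr 1
    simpa using this
  have cP : Commute P (derivative P) := by
    rw [dP, hP]
    have e1 := comm1 (x + y) (x + y) 1 0 rfl
    have e2 := comm1 (x + y) c 1 1 cc
    have e3 := comm1 ((1 / 2 : ℚ) • c) (x + y) 2 0 (cc.symm.smul_left _)
    have e4 := comm1 ((1 / 2 : ℚ) • c) c 2 1 ((Commute.refl c).smul_left _)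
    simp only [pow_zero, pow_one, mul_one] at e1 e2 e3 e4
    exact (e1.add_right e2).add_left (e3.add_right e4)
  have da : derivative a = C x := by simp [ha]
  have db : derivative b = C y := by simp [hb]
  have ca : Commute a (derivative a) := by
    rw [da]; simpa using comm1 x x 1 0 rfl
  have cb : Commute b (derivative b) := by
    rw [db]; simpa using comm1 y y 1 0 rfl
  have hD : derivative (IsNilpotent.exp a * (IsNilpotent.exp b * IsNilpotent.exp (-P))) = 0 := by
    have nc : Commute (-P) (derivative (-P)) := by
      rw [derivative_neg]; exact cP.neg_left.neg_right
    have hx1 : C x * IsNilpotent.exp b = IsNilpotent.exp b * (C x + C c * X) := by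
      refine aux_mul_exp _ _ _ ?_ ?_ nb
      · rw [hb, ← mul_assoc, ← C_mul, mul_assoc, X_mul_C, ← mul_assoc, ← C_mul, ← add_mul,
          ← C_add, ← hc]
        congr 2
        abel
      · simpa using comm1 c y 1 1 hcy
    have hneg : IsNilpotent.exp (-P) * derivative P = derivative P * IsNilpotent.exp (-P) := by
      have := aux_mul_exp (derivative P) (-P) 0 (by simp [cP.eq]) (Commute.zero_left _) nP.neg
      rw [this, add_zero]
    rw [derivative_mul, derivative_mul, aux_deriv_exp a ca na, aux_deriv_exp b cb nb,
      aux_deriv_exp _ nc nP.neg, da, db, derivative_neg, mul_neg, hneg, dP]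
    rw [mul_assoc (IsNilpotent.exp a), ← mul_assoc (C x), hx1, C_add]
    noncomm_ring
  have h01 := aux_const _ hD
  have ev : ∀ q : ℚ, evq q (IsNilpotent.exp a * (IsNilpotent.exp b * IsNilpotent.exp (-P))) =
      IsNilpotent.exp (evq q a) * (IsNilpotent.exp (evq q b) * IsNilpotent.exp (-(evq q P))) := by
    intro q
    rw [map_mul, map_mul, IsNilpotent.map_exp na, IsNilpotent.map_exp nb,
      IsNilpotent.map_exp nP.neg, map_neg]
  rw [ev, ev] at h01
  simp only [ha, hb, hP, map_add, map_mul, map_pow, evq_C, evq_X, map_one, map_zero, mul_zero,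
    mul_one, one_pow, ne_eq, OfNat.ofNat_ne_zero, not_false_eq_true, zero_pow, add_zero, neg_zero,
    IsNilpotent.exp_zero] at h01
  have nZ : IsNilpotent (x + y + (1 / 2 : ℚ) • c) :=
    Commute.isNilpotent_add (cc.smul_right _) hxy (hcn.smul _)
  have h5 := IsNilpotent.exp_neg_mul_exp_self nZ
  calc _ = IsNilpotent.exp x * IsNilpotent.exp y * (IsNilpotent.exp (-(x + y + (1 / 2 : ℚ) • c)) *
        IsNilpotent.exp (x + y + (1 / 2 : ℚ) • c)) := by rw [h5, mul_one]
    _ = _ := by rw [← mul_assoc, mul_assoc (IsNilpotent.exp x), h01, one_mul]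

theorem aux_log_nil {S : Type*} [Ring S] [Algebra ℚ S] (n : ℕ) (a : S) (ha : IsNilpotent a) :
    IsNilpotent (∑ k ∈ Finset.range n, ((-1 : ℚ) ^ k / (k + 1)) • a ^ (k + 1)) := by
  apply Commute.isNilpotent_sum
  · intro i _
    exact (ha.pow_of_pos (by omega)).smul _
  · intro i j _ _
    exact ((Commute.pow_pow (Commute.refl a) _ _).smul_left _).smul_right _

theorem aux_exp_log (n : ℕ) (N : R) (hN : N ^ n = 0) :
    IsNilpotent.exp (∑ k ∈ Finset.range n, ((-1 : ℚ) ^ k / (k + 1)) • N ^ (k + 1)) = 1 + N := by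
  set M : R[X] := C N * X with hM
  have hMN : Commute (C N : R[X]) X := (commute_X _).symm
  have hMn : M ^ n = 0 := by
    rw [hM, hMN.mul_pow, ← C_pow, hN]; simp
  set P : R[X] := ∑ k ∈ Finset.range n, ((-1 : ℚ) ^ k / (k + 1)) • M ^ (k + 1) with hP
  have nP : IsNilpotent P := aux_log_nil n M ⟨n, hMn⟩
  have dM : derivative M = C N := by simp [hM]
  have cM : Commute M (C N) := by
    rw [hM]; exact (Commute.refl _).mul_left (commute_X _)
  have dP : derivative P = (∑ k ∈ Finset.range n, (-M) ^ k) * C N := by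
    rw [hP, map_sum, Finset.sum_mul]
    refine Finset.sum_congr rfl fun k _ => ?_
    rw [derivative_smul, aux_deriv_pow M (by rw [dM]; exact cM), smul_smul, dM]
    have h3 : (k : ℚ) + 1 ≠ 0 := by positivity
    rw [div_mul_cancel₀ _ h3, neg_pow M k]
    rcases Nat.even_or_odd k with h | h <;> simp [h.neg_one_pow]
  have cP1 : Commute M P := by
    rw [hP]
    exact Commute.sum_right _ _ _ fun k _ => ((Commute.refl M).pow_right _).smul_right _
  have cP2 : Commute (C N) P := by
    rw [hP]
    exact Commute.sum_right _ _ _ fun k _ => (cM.symm.pow_right _).smul_right _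
  have cP : Commute P (derivative P) := by
    rw [dP]
    refine Commute.mul_right ?_ cP2.symm
    exact Commute.sum_right _ _ _ fun k _ => (cP1.symm.neg_right).pow_right _
  have hD : derivative (IsNilpotent.exp (-P) * (1 + M)) = 0 := by
    rw [derivative_mul, aux_deriv_exp (-P) (by rw [derivative_neg]; exact cP.neg_left.neg_right)
      nP.neg, derivative_neg, dP, derivative_add, dM, derivative_one, zero_add]
    have hg : (∑ k ∈ Finset.range n, (-M) ^ k) * (1 + M) = 1 := by
      have := geom_sum_mul (-M) n
      rw [neg_pow, hMn, mul_zero] at this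
      have h2 : (1 + M) = -(-M - 1) := by abel
      rw [h2, mul_neg, this]; simp
    have h2 : (∑ k ∈ Finset.range n, (-M) ^ k) * C N * (1 + M) = C N := by
      have h3 : C N * (1 + M) = (1 + M) * C N := by
        rw [mul_add, add_mul, cM.eq, mul_one, one_mul]
      rw [mul_assoc, h3, ← mul_assoc, hg, one_mul]
    rw [mul_neg, neg_mul, mul_assoc, h2]
    simp
  have h01 := aux_const _ hD
  rw [map_mul, map_mul, IsNilpotent.map_exp nP.neg, IsNilpotent.map_exp nP.neg] at h01
  simp only [map_mul, map_neg, map_add, map_one, hP, map_sum,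
    map_rat_smul, map_pow, hM, evq_C, evq_X, mul_one, map_zero, mul_zero] at h01
  have nZ := aux_log_nil n N ⟨n, hN⟩
  have h5 := IsNilpotent.exp_mul_exp_neg_self nZ
  have h6 : IsNilpotent.exp (-∑ k ∈ Finset.range n, ((-1 : ℚ) ^ k / (k + 1)) • N ^ (k + 1)) *
      (1 + N) = 1 := by
    rw [h01]; simp
  calc _ = IsNilpotent.exp (∑ k ∈ Finset.range n, ((-1 : ℚ) ^ k / (k + 1)) • N ^ (k + 1)) *
        (IsNilpotent.exp (-∑ k ∈ Finset.range n, ((-1 : ℚ) ^ k / (k + 1)) • N ^ (k + 1)) *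
      (1 + N)) := by rw [h6, mul_one]
    _ = _ := by rw [← mul_assoc, h5, one_mul]

theorem aux_exp_eq_one (m : R) (hm : IsNilpotent m) (h : IsNilpotent.exp m = 1) : m = 0 := by
  obtain ⟨k, hk⟩ := hm
  have key : ∀ j, m ^ (j + 1) = 0 → m = 0 := by
    intro j
    induction j with
    | zero => intro h; simpa using h
    | succ j ih =>
      intro hj
      apply ih
      rw [IsNilpotent.exp_eq_sum hj, Finset.sum_range_succ', Finset.sum_range_succ'] at h
      have h2 := congrArg (fun z => m ^ j * z) h
      simp only [mul_add, Finset.mul_sum, mul_smul_comm, ← pow_add] at h2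
      rw [Finset.sum_eq_zero] at h2
      · simpa using h2
      · intro i _
        rw [show j + (i + 1 + 1) = (j + 1 + 1) + i by ring, pow_add, hj]; simp
  exact key k (by rw [pow_succ, hk, zero_mul])

theorem aux_exp_inj (x y : R) (hx : IsNilpotent x) (hy : IsNilpotent y) (hc : Commute x y)
    (h : IsNilpotent.exp x = IsNilpotent.exp y) : x = y := by
  have h1 : IsNilpotent.exp (x + -y) = 1 := by
    rw [IsNilpotent.exp_add_of_commute hc.neg_right hx hy.neg, h,
      IsNilpotent.exp_mul_exp_neg_self hy]
  have h2 := aux_exp_eq_one _ (Commute.isNilpotent_add hc.neg_right hx hy.neg) h1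
  exact add_neg_eq_zero.1 h2

end Aux

section Mat
variable {n : ℕ}

theorem su_nil (X : Matrix (Fin n) (Fin n) ℚ) (h : IsStrictUpper X) : X ^ n = 0 := by
  have h1 : X.BlockTriangular id := fun i j hij => h i j (le_of_lt hij)
  have h2 := Matrix.charpoly_of_isUpperTriangular X h1
  have h3 := Matrix.aeval_self_charpoly X
  rw [h2] at h3
  simpa [h _ _ (le_refl _)] using h3

theorem su_add {X Y : Matrix (Fin n) (Fin n) ℚ} (hX : IsStrictUpper X) (hY : IsStrictUpper Y) :
    IsStrictUpper (X + Y) := fun i j h => by simp [hX i j h, hY i j h]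

theorem su_sub {X Y : Matrix (Fin n) (Fin n) ℚ} (hX : IsStrictUpper X) (hY : IsStrictUpper Y) :
    IsStrictUpper (X - Y) := fun i j h => by simp [hX i j h, hY i j h]

theorem su_smul {X : Matrix (Fin n) (Fin n) ℚ} (q : ℚ) (hX : IsStrictUpper X) :
    IsStrictUpper (q • X) := fun i j h => by simp [hX i j h]

theorem su_mul {X Y : Matrix (Fin n) (Fin n) ℚ} (hX : IsStrictUpper X) (hY : IsStrictUpper Y) :
    IsStrictUpper (X * Y) := fun i j h => by
  rw [Matrix.mul_apply]
  refine Finset.sum_eq_zero fun k _ => ?_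
  rcases le_or_gt k i with h1 | h1
  · rw [hX i k h1, zero_mul]
  · rw [hY k j (h.trans h1.le), mul_zero]

theorem su_pow {X : Matrix (Fin n) (Fin n) ℚ} (hX : IsStrictUpper X) (k : ℕ) :
    IsStrictUpper (X ^ (k + 1)) := by
  induction k with
  | zero => simpa using hX
  | succ k ih => rw [pow_succ]; exact su_mul ih hX

theorem su_of_uni {A : Matrix (Fin n) (Fin n) ℚ} (hA : IsUnitriangular A) :
    IsStrictUpper (A - 1) := fun i j h => by
  rcases eq_or_lt_of_le h with h1 | h1
  · subst h1; simp [hA.1]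
  · simp [hA.2 i j h1, Matrix.one_apply_ne h1.ne']

theorem mlog_eq (A : Matrix (Fin n) (Fin n) ℚ) :
    mlog A = ∑ k ∈ Finset.range n, ((-1 : ℚ) ^ k / (k + 1)) • (A - 1) ^ (k + 1) := by
  have h := Finset.sum_Ico_add' (fun k : ℕ =>
    ((-1 : ℚ) ^ (k - 1) / (k : ℚ)) • (A - 1) ^ k) 0 n 1
  have h2 : Finset.Icc 1 n = Finset.Ico (0 + 1) (n + 1) := by
    ext; simp
  rw [mlog, h2, ← h, Finset.range_eq_Ico]
  simp

theorem su_mlog {A : Matrix (Fin n) (Fin n) ℚ} (hA : IsUnitriangular A) :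
    IsStrictUpper (mlog A) := fun i j h => by
  rw [mlog_eq, Matrix.sum_apply]
  exact Finset.sum_eq_zero fun k _ => su_smul _ (su_pow (su_of_uni hA) k) i j h

theorem exp_mlog {A : Matrix (Fin n) (Fin n) ℚ} (hA : IsUnitriangular A) :
    IsNilpotent.exp (mlog A) = A := by
  rw [mlog_eq, aux_exp_log n _ (su_nil _ (su_of_uni hA))]
  abel

theorem mlog_mul {A B : Matrix (Fin n) (Fin n) ℚ} (hA : IsUnitriangular A)
    (hB : IsUnitriangular B) (hAB : IsUnitriangular (A * B))
    (h1 : mcomm (mcomm (mlog A) (mlog B)) (mlog A) = 0)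
    (h2 : mcomm (mcomm (mlog A) (mlog B)) (mlog B) = 0) :
    mlog (A * B) = mlog A + mlog B + (1 / 2 : ℚ) • mcomm (mlog A) (mlog B) := by
  have sA := su_mlog hA
  have sB := su_mlog hB
  have sC : IsStrictUpper (mcomm (mlog A) (mlog B)) := su_sub (su_mul sA sB) (su_mul sB sA)
  have sZ := su_add (su_add sA sB) (su_smul (1 / 2) sC)
  have nil : ∀ {X : Matrix (Fin n) (Fin n) ℚ}, IsStrictUpper X → IsNilpotent X :=
    fun h => ⟨n, su_nil _ h⟩
  have hb := aux_bch (mlog A) (mlog B) (mcomm (mlog A) (mlog B)) rfl (sub_eq_zero.1 h1)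
    (sub_eq_zero.1 h2) (nil sA) (nil sB) (nil (su_add sA sB)) (nil sC)
  rw [exp_mlog hA, exp_mlog hB] at hb
  refine aux_exp_inj _ _ (nil (su_mlog hAB)) (nil sZ) ?_ ((exp_mlog hAB).trans hb)
  set Z := mlog A + mlog B + (1 / 2 : ℚ) • mcomm (mlog A) (mlog B) with hZ
  have cZ : Commute (A * B) Z := by
    rw [hb, IsNilpotent.exp_eq_sum (su_nil _ sZ)]
    exact Commute.sum_left _ _ _ fun k _ => ((Commute.refl Z).pow_left _).smul_left _
  rw [mlog_eq]
  exact Commute.sum_left _ _ _ fun k _ =>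
    ((cZ.sub_left (Commute.one_left Z)).pow_left _).smul_left _

theorem delta_sum {K : ℕ} (L : Fin K → Matrix (Fin n) (Fin n) ℚ) (a : Fin K) (w : List (Fin K)) :
    ∑ i : Fin K, ∑ j ∈ Finset.Ioi i, (delta i j (a :: w) : ℚ) • mcomm (L i) (L j) =
    (∑ i : Fin K, ∑ j ∈ Finset.Ioi i, (delta i j w : ℚ) • mcomm (L i) (L j)) +
      ∑ j : Fin K, (w.count j : ℚ) • mcomm (L a) (L j) := by
  have e1 : ∀ i j : Fin K, (delta i j (a :: w) : ℚ) • mcomm (L i) (L j) =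
      (delta i j w : ℚ) • mcomm (L i) (L j) +
        ((if a = i then (w.count j : ℚ) • mcomm (L a) (L j) else 0) +
         (if a = j then (w.count i : ℚ) • mcomm (L a) (L i) else 0)) := by
    intro i j
    have hsk : mcomm (L i) (L j) = - mcomm (L j) (L i) := by simp [mcomm]
    simp only [delta]
    by_cases h1 : a = i <;> by_cases h2 : a = j
    · subst h1; subst h2; simp [mcomm]
    · subst h1; simp [h2, add_smul]
    · subst h2; simp [h1]; rw [hsk]; module
    · simp [h1, h2]
  simp only [e1, Finset.sum_add_distrib]
  congr 1
  have e2 : ∑ i : Fin K, ∑ j ∈ Finset.Ioi i,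
      (if a = i then (w.count j : ℚ) • mcomm (L a) (L j) else 0) =
      ∑ j ∈ Finset.Ioi a, (w.count j : ℚ) • mcomm (L a) (L j) := by
    rw [Finset.sum_eq_single a]
    · simp
    · intro i _ hi; simp [Ne.symm hi]
    · simp
  have e3 : ∑ i : Fin K, ∑ j ∈ Finset.Ioi i,
      (if a = j then (w.count i : ℚ) • mcomm (L a) (L i) else 0) =
      ∑ i ∈ Finset.Iio a, (w.count i : ℚ) • mcomm (L a) (L i) := by
    simp only [Finset.sum_ite_eq, Finset.mem_Ioi]
    rw [← Finset.sum_filter]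
    refine Finset.sum_congr ?_ fun _ _ => rfl
    ext; simp
  rw [e2, e3, ← Finset.sum_add_sum_compl (Finset.Ioi a)]
  congr 1
  have : (Finset.Ioi a)ᶜ = insert a (Finset.Iio a) := by
    ext; simp [le_iff_eq_or_lt]
  rw [this, Finset.sum_insert (by simp)]
  simp [mcomm]

end Mat

/-- BCH formula for a word over an alphabet 𝒢 = {A_1,…,A_K} in a 2-step nilpotent
subgroup of UT(n, ℚ): log of the product equals Σ ℓ_i log A_i +
(1/2) Σ_{i<j} δ_ij(w) [log A_i, log A_j], where ℓ is the Parikh image of w. -/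
theorem stmt8 (n K : ℕ) (G : Set (Matrix (Fin n) (Fin n) ℚ))
    (hUT : ∀ A ∈ G, IsUnitriangular A)
    (hone : (1 : Matrix (Fin n) (Fin n) ℚ) ∈ G)
    (hmul : ∀ A ∈ G, ∀ B ∈ G, A * B ∈ G)
    (hinv : ∀ A ∈ G, ∃ B ∈ G, A * B = 1 ∧ B * A = 1)
    (h2step : ∀ X ∈ G, ∀ Y ∈ G, ∀ Z ∈ G, mcomm (mcomm (mlog X) (mlog Y)) (mlog Z) = 0)
    (A : Fin K → Matrix (Fin n) (Fin n) ℚ) (hA : ∀ i, A i ∈ G)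
    (w : List (Fin K)) :
    mlog (w.map A).prod =
      (∑ i : Fin K, (w.count i : ℚ) • mlog (A i)) +
        (1 / 2 : ℚ) • ∑ i : Fin K, ∑ j ∈ Finset.Ioi i,
          (delta i j w : ℚ) • mcomm (mlog (A i)) (mlog (A j)) := by
  have main : ∀ w : List (Fin K), (w.map A).prod ∈ G ∧ mlog (w.map A).prod =
      (∑ i : Fin K, (w.count i : ℚ) • mlog (A i)) +
        (1 / 2 : ℚ) • ∑ i : Fin K, ∑ j ∈ Finset.Ioi i,
          (delta i j w : ℚ) • mcomm (mlog (A i)) (mlog (A j)) := by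
    intro w
    induction w with
    | nil => exact ⟨by simpa using hone, by simp [mlog_eq, delta]⟩
    | cons a w ih =>
      obtain ⟨hG, hlog⟩ := ih
      rw [List.map_cons, List.prod_cons]
      have hm := hmul _ (hA a) _ hG
      refine ⟨hm, ?_⟩
      rw [mlog_mul (hUT _ (hA a)) (hUT _ hG) (hUT _ hm) (h2step _ (hA a) _ hG _ (hA a))
        (h2step _ (hA a) _ hG _ hG)]
      have hc : mcomm (mlog (A a)) (mlog (w.map A).prod) =
          ∑ j : Fin K, (w.count j : ℚ) • mcomm (mlog (A a)) (mlog (A j)) := by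
        rw [hlog]
        set D := ∑ i : Fin K, ∑ j ∈ Finset.Ioi i,
          (delta i j w : ℚ) • mcomm (mlog (A i)) (mlog (A j)) with hD
        have hcD : Commute (mlog (A a)) D := by
          rw [hD]
          refine Commute.sum_right _ _ _ fun i _ => Commute.sum_right _ _ _ fun j _ =>
            Commute.smul_right ?_ _
          exact (sub_eq_zero.1 (h2step _ (hA i) _ (hA j) _ (hA a))).symm
        have hcD2 := (hcD.smul_right (1 / 2 : ℚ)).eq
        simp only [mcomm, mul_add, add_mul, hcD2, Finset.mul_sum, Finset.sum_mul, smul_sub,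
          Finset.sum_sub_distrib, mul_smul_comm, smul_mul_assoc]
        abel
      rw [hc, hlog, delta_sum (fun i => mlog (A i)) a w]
      have hcount : ∑ i : Fin K, ((a :: w).count i : ℚ) • mlog (A i) =
          mlog (A a) + ∑ i : Fin K, (w.count i : ℚ) • mlog (A i) := by
        simp only [List.count_cons, Nat.cast_add, add_smul, Finset.sum_add_distrib]
        rw [add_comm]
        congr 1
        rw [Finset.sum_eq_single a]
        · simp
        · intro i _ hi; simp [Ne.symm hi]
        · simp
      rw [hcount, smul_add]
      abel
  exact (main w).2
end

section
/- Let 𝒢 = {A_1,...,A_K} and ℋ = {B_1,...,B_M} be finite subsets of H_3(ℚ), let S ∈ H_3(ℚ), and suppose the cone generated by {φ(log A_i)} intersected with the cone generated by {φ(log B_j)} in ℚ² has dimension two. Then ⟨𝒢⟩ ∩ S·⟨ℋ⟩ ≠ ∅ if and only if there exist integers x_i, y_j, c_{ij} (1 ≤ i < j ≤ K), d_{ij} (1 ≤ i < j ≤ M) with x_i, y_j ≥ 0 satisfying: (1) Σ x_i φ(log A_i) = φ(log S) + Σ y_j φ(log B_j); (2) Σ x_i π(log A_i) + (1/2)Σ_{i<j}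 c_{ij} π([log A_i, log A_j]) = π(log S) + Σ y_j π(log B_j + (1/2)[log S, log B_j]) + (1/2)Σ_{i<j} d_{ij} π([log B_i, log B_j]); and (3) c_{ij} ≡ x_i x_j (mod 2), d_{ij} ≡ y_i y_j (mod 2). -/
/-- Superdiagonal projection φ on the Lie algebra of H₃(ℚ). -/
def phi (X : Matrix (Fin 3) (Fin 3) ℚ) : Fin 2 → ℚ := ![X 0 1, X 1 2]

/-- Upper-right-corner projection π on the Lie algebra of H₃(ℚ). -/
def pi13 (X : Matrix (Fin 3) (Fin 3) ℚ) : ℚ := X 0 2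

/-- The cone in ℚ² generated by a finite family of vectors. -/
def coneGen {K : ℕ} (u : Fin K → (Fin 2 → ℚ)) : Set (Fin 2 → ℚ) :=
  {x | ∃ c : Fin K → ℚ, (∀ i, 0 ≤ c i) ∧ x = ∑ i, c i • u i}

namespace HeisAux

/-- Heisenberg element in logarithmic coordinates. -/
def hm (a b z : ℚ) : Matrix (Fin 3) (Fin 3) ℚ := !![1, a, z + a * b / 2; 0, 1, b; 0, 0, 1]

lemma hm_mul (a b z a' b' z' : ℚ) :
    hm a b z * hm a' b' z' = hm (a + a') (b + b') (z + z' + (a * b' - a' * b) / 2) := by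
  ext i j
  fin_cases i <;> fin_cases j <;> simp [hm, Matrix.mul_apply, Fin.sum_univ_three] <;> ring

lemma hm_inj {a b z a' b' z' : ℚ} (h : hm a b z = hm a' b' z') : a = a' ∧ b = b' ∧ z = z' := by
  have h1 := congrFun (congrFun h 0) 1
  have h2 := congrFun (congrFun h 1) 2
  have h3 := congrFun (congrFun h 0) 2
  simp [hm] at h1 h2 h3
  subst h1 h2
  exact ⟨rfl, rfl, by linarith⟩

lemma hm_zero : hm 0 0 0 = 1 := by
  ext i j
  fin_cases i <;> fin_cases j <;> simp [hm]

lemma exists_hm {A : Matrix (Fin 3) (Fin 3) ℚ} (h : IsUnitriangular A) :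
    ∃ a b z, A = hm a b z := by
  refine ⟨A 0 1, A 1 2, A 0 2 - A 0 1 * A 1 2 / 2, ?_⟩
  obtain ⟨h1, h2⟩ := h
  ext i j
  fin_cases i <;> fin_cases j <;> simp [hm, h1] <;> exact h2 _ _ (by decide)

lemma mlog_hm (a b z : ℚ) : mlog (hm a b z) = !![0, a, z; 0, 0, b; 0, 0, 0] := by
  have e : hm a b z - 1 = !![0, a, z + a * b / 2; 0, 0, b; 0, 0, 0] := by
    ext i j
    fin_cases i <;> fin_cases j <;> simp [hm]
  have hI : Finset.Icc 1 3 = ({1, 2, 3} : Finset ℕ) := by decide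
  unfold mlog
  rw [hI, e]
  ext i j
  fin_cases i <;> fin_cases j <;>
    simp [pow_succ, Matrix.mul_apply, Fin.sum_univ_three] <;> ring

lemma phi_hm (a b z : ℚ) : phi (mlog (hm a b z)) = ![a, b] := by
  rw [mlog_hm]; simp [phi]

lemma pi_hm (a b z : ℚ) : pi13 (mlog (hm a b z)) = z := by
  rw [mlog_hm]; simp [pi13]

lemma comm_hm (a b z a' b' z' : ℚ) :
    pi13 (mcomm (mlog (hm a b z)) (mlog (hm a' b' z'))) = a * b' - a' * b := by
  rw [mlog_hm, mlog_hm]; simp [pi13, mcomm, Matrix.mul_apply, Fin.sum_univ_three]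

/-- Signed number of (i before j) minus (j before i). -/
def sc {K : ℕ} (i j : Fin K) : List (Fin K) → ℤ
  | [] => 0
  | k :: v => sc i j v + (if k = i then (v.count j : ℤ) else 0)
      - (if k = j then (v.count i : ℤ) else 0)

lemma sc_append {K : ℕ} (i j : Fin K) (v w : List (Fin K)) :
    sc i j (v ++ w) = sc i j v + sc i j w + v.count i * w.count j - v.count j * w.count i := by
  induction v with
  | nil => simp [sc]
  | cons k v ih =>
    simp only [List.cons_append, sc, ih, List.count_cons, List.count_append, beq_iff_eq]
    split_ifs <;> push_cast <;> ring

lemma sc_reverse {K : ℕ} (i j : Fin K) (v : List (Fin K)) :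
    sc i j v.reverse = - sc i j v := by
  induction v with
  | nil => simp [sc]
  | cons k v ih =>
    simp only [List.reverse_cons, sc_append, ih, sc, List.count_cons, List.count_reverse,
      beq_iff_eq, List.count_nil]
    split_ifs <;> push_cast <;> ring

lemma sc_replicate {K : ℕ} (i j k : Fin K) (n : ℕ) : sc i j (List.replicate n k) = 0 := by
  induction n with
  | zero => simp [sc]
  | succ n ih =>
    simp only [List.replicate_succ, sc, ih, List.count_replicate, beq_iff_eq]
    split_ifs <;> simp_all

lemma sc_parity {K : ℕ} {i j : Fin K} (hij : i ≠ j) (v : List (Fin K)) :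
    sc i j v ≡ (v.count i : ℤ) * (v.count j : ℤ) [ZMOD 2] := by
  have key : ∃ m : ℤ, sc i j v = (v.count i : ℤ) * (v.count j : ℤ) + 2 * m := by
    induction v with
    | nil => exact ⟨0, by simp [sc]⟩
    | cons k v ih =>
      obtain ⟨m, hm⟩ := ih
      simp only [sc, hm, List.count_cons, beq_iff_eq]
      by_cases h1 : k = i
      · have h2 : k ≠ j := fun h => hij (h1.symm.trans h)
        exact ⟨m, by simp only [if_pos h1, if_neg h2]; push_cast; ring⟩
      · by_cases h2 : k = j
        · exact ⟨m - v.count i, by simp only [if_neg h1, if_pos h2]; push_cast; ring⟩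
        · exact ⟨m, by simp only [if_neg h1, if_neg h2]; push_cast; ring⟩
  obtain ⟨m, hm⟩ := key
  rw [hm]
  exact (Int.modEq_iff_dvd.mpr ⟨-m, by ring⟩)

/-- Evaluation of words in logarithmic coordinates. -/
lemma prod_hm {K : ℕ} (a b z : Fin K → ℚ) (v : List (Fin K)) :
    (v.map (fun i => hm (a i) (b i) (z i))).prod =
      hm (∑ i, (v.count i : ℚ) * a i) (∑ i, (v.count i : ℚ) * b i)
        ((∑ i, (v.count i : ℚ) * z i) + (1 / 2 : ℚ) * ∑ i, ∑ j ∈ Finset.Ioi i,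
          (sc i j v : ℚ) * (a i * b j - a j * b i)) := by
  induction v with
  | nil => simp [sc, hm_zero]
  | cons k v ih =>
    have hc : ∀ f : Fin K → ℚ, ∑ i, ((k :: v).count i : ℚ) * f i
        = f k + ∑ i, (v.count i : ℚ) * f i := by
      intro f
      simp only [List.count_cons, beq_iff_eq]
      push_cast
      simp [add_mul, Finset.sum_add_distrib, add_comm]
    have hs : ∑ i, ∑ j ∈ Finset.Ioi i, (sc i j (k :: v) : ℚ) * (a i * b j - a j * b i)
        = (∑ i, ∑ j ∈ Finset.Ioi i, (sc i j v : ℚ) * (a i * b j - a j * b i))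
          + ∑ j, (v.count j : ℚ) * (a k * b j - a j * b k) := by
      have hI : ∀ i : Fin K, Finset.Ioi i = Finset.univ.filter (fun j => i < j) := by
        intro i; ext; simp
      simp only [hI, Finset.sum_filter]
      have h1 : ∑ j, (v.count j : ℚ) * (a k * b j - a j * b k)
          = (∑ i, ∑ j, if i < j then (if k = i then (v.count j : ℚ) else 0)
              * (a i * b j - a j * b i) else 0)
            - ∑ j, ∑ i, if i < j then (if k = j then (v.count i : ℚ) else 0)
              * (a i * b j - a j * b i) else 0 := by
        have e1 : ∀ i, (∑ j, if i < j then (if k = i then (v.count j : ℚ) else 0)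
              * (a i * b j - a j * b i) else 0) = if k = i then
              ∑ j, (if i < j then (v.count j : ℚ) * (a i * b j - a j * b i) else 0) else 0 := by
          intro i; split_ifs <;> simp
        have e2 : ∀ j, (∑ i, if i < j then (if k = j then (v.count i : ℚ) else 0)
              * (a i * b j - a j * b i) else 0) = if k = j then
              ∑ i, (if i < j then (v.count i : ℚ) * (a i * b j - a j * b i) else 0) else 0 := by
          intro i; split_ifs <;> simp
        simp only [e1, e2, Finset.sum_ite_eq, Finset.mem_univ, if_true]
        rw [← Finset.sum_sub_distrib]
        refine Finset.sum_congr rfl fun j _ => ?_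
        rcases lt_trichotomy k j with h | h | h
        · simp [h, h.not_gt]
        · subst h; simp
        · simp [h, h.not_gt]; ring
      rw [h1, Finset.sum_comm (f := fun j i => if i < j then
        (if k = j then (v.count i : ℚ) else 0) * (a i * b j - a j * b i) else 0)]
      rw [← Finset.sum_sub_distrib, ← Finset.sum_add_distrib]
      refine Finset.sum_congr rfl fun i _ => ?_
      rw [← Finset.sum_sub_distrib, ← Finset.sum_add_distrib]
      refine Finset.sum_congr rfl fun j _ => ?_
      simp only [sc]
      split_ifs <;> push_cast <;> ring
    rw [List.map_cons, List.prod_cons, ih, hm_mul, hc, hc, hc, hs]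
    congr 1
    have : ∑ j, (v.count j : ℚ) * (a k * b j - a j * b k) =
        a k * ∑ j, (v.count j : ℚ) * b j - (∑ j, (v.count j : ℚ) * a j) * b k := by
      rw [Finset.mul_sum, Finset.sum_mul, ← Finset.sum_sub_distrib]
      exact Finset.sum_congr rfl fun j _ => by ring
    rw [this]; ring

/-- Realizability of counts and signed counts. -/
def Rlz {K : ℕ} (x : Fin K → ℕ) (c : Fin K → Fin K → ℤ) : Prop :=
  ∃ v : List (Fin K), (∀ i, v.count i = x i) ∧ ∀ i j, i < j → sc i j v = c i j

lemma exists_word {K : ℕ} (x : Fin K → ℕ) : ∃ v : List (Fin K), ∀ i, v.count i = x i := by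
  refine ⟨(∑ i, x i • ({i} : Multiset (Fin K))).toList, fun i => ?_⟩
  rw [← Multiset.coe_count, Multiset.coe_toList, Multiset.count_sum']
  simp [Multiset.count_singleton]

lemma count_rep {K : ℕ} (a b : Fin K) (n : ℕ) :
    (List.replicate n b).count a = if a = b then n else 0 := by
  rw [List.count_replicate]
  by_cases h : a = b
  · simp [h]
  · have h' : b ≠ a := fun e => h e.symm
    simp [h, h']

lemma sc_wrap {K : ℕ} (i j : Fin K) (V X V' : List (Fin K)) (h : ∀ i, V.count i = V'.count i) :
    sc i j (V ++ X ++ V') = sc i j X + sc i j V + sc i j V' := by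
  simp only [sc_append, List.count_append, h]
  push_cast; ring

lemma Rlz.fill {K : ℕ} {x : Fin K → ℕ} {c : Fin K → Fin K → ℤ} (h : Rlz x c)
    (z : Fin K → ℕ) : Rlz (fun i => x i + 2 * z i) c := by
  obtain ⟨X, h1, h2⟩ := h
  obtain ⟨V, hV⟩ := exists_word z
  refine ⟨V ++ X ++ V.reverse, fun i => ?_, fun i j hij => ?_⟩
  · simp [h1, hV]; ring
  · rw [sc_wrap _ _ _ _ _ (by simp), sc_reverse, h2 i j hij]; ring

lemma Rlz.pair {K : ℕ} {x : Fin K → ℕ} {c : Fin K → Fin K → ℤ} (h : Rlz x c)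
    {k l : Fin K} (hkl : k < l) (m : ℤ) (n : ℕ) :
    Rlz (fun i => x i + 2 * ((if i = k then m.natAbs * n else 0) + (if i = l then n else 0)))
      (fun i j => c i j + 2 * (if i = k ∧ j = l then m * (n : ℤ) ^ 2 else 0)) := by
  obtain ⟨X, h1, h2⟩ := h
  have key : ∃ V : List (Fin K),
      (∀ i, V.count i = (if i = k then m.natAbs * n else 0) + (if i = l then n else 0)) ∧
      ∀ i j, i < j → sc i j V = if i = k ∧ j = l then m * (n : ℤ) ^ 2 else 0 := by
    rcases le_total 0 m with hm | hm
    · refine ⟨List.replicate (m.natAbs * n) k ++ List.replicate n l, fun i => ?_,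
        fun i j hij => ?_⟩
      · simp only [List.count_append, count_rep]
      · have : (m.natAbs : ℤ) = m := by omega
        rw [sc_append, sc_replicate, sc_replicate]
        simp only [count_rep]
        by_cases a1 : i = k
        · have a4 : j ≠ k := fun e => by omega
          by_cases a2 : j = l
          · simp only [a1, a2, hkl.ne, hkl.ne', and_self, if_true, if_false]
            rw [Nat.cast_mul, this]; push_cast; ring
          · simp [a2, a4]
        · by_cases a3 : i = l
          · have a2 : j ≠ l := fun e => by omega
            have a4 : j ≠ k := fun e => by omega
            simp [a1, a2, a4]
          · simp [a1, a3]
    · refine ⟨List.replicate n l ++ List.replicate (m.natAbs * n) k, fun i => ?_,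
        fun i j hij => ?_⟩
      · simp only [List.count_append, count_rep]; ring
      · have : (m.natAbs : ℤ) = -m := by omega
        rw [sc_append, sc_replicate, sc_replicate]
        simp only [count_rep]
        by_cases a1 : i = k
        · have a4 : j ≠ k := fun e => by omega
          by_cases a2 : j = l
          · simp only [a1, a2, hkl.ne, hkl.ne', and_self, if_true, if_false]
            rw [Nat.cast_mul, this]; push_cast; ring
          · simp [a2, a4]
        · by_cases a3 : i = l
          · have a2 : j ≠ l := fun e => by omega
            have a4 : j ≠ k := fun e => by omega
            simp [a1, a2, a4]
          · simp [a1, a3]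
  obtain ⟨V, hV1, hV2⟩ := key
  refine ⟨V ++ X ++ V, fun i => ?_, fun i j hij => ?_⟩
  · simp [h1, hV1]; ring
  · rw [sc_wrap _ _ _ _ _ (by simp), h2 i j hij, hV2 i j hij]; ring

lemma real_of_parity {K : ℕ} (x : Fin K → ℕ) (c : Fin K → Fin K → ℤ)
    (hc : ∀ i j : Fin K, i < j → c i j ≡ (x i : ℤ) * (x j : ℤ) [ZMOD 2]) :
    ∃ Z : Fin K → ℕ, Rlz (fun i => x i + 2 * Z i) c := by
  obtain ⟨X, hX⟩ := exists_word x
  have hm : ∀ i j, ∃ m : ℤ, i < j → c i j = sc i j X + 2 * m := by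
    intro i j
    by_cases hij : i < j
    · have h1 := sc_parity hij.ne X
      rw [hX, hX] at h1
      obtain ⟨m, hm⟩ := (h1.trans (hc i j hij).symm).dvd
      exact ⟨m, fun _ => by linarith⟩
    · exact ⟨0, fun h => absurd h hij⟩
  choose m hm using hm
  have key : ∀ s : Finset (Fin K × Fin K), (∀ q ∈ s, q.1 < q.2) →
      ∃ Z : Fin K → ℕ, Rlz (fun i => x i + 2 * Z i)
        (fun i j => sc i j X + 2 * (if (i, j) ∈ s then m i j else 0)) := by
    intro s
    induction s using Finset.induction_on with
    | empty => exact fun _ => ⟨0, X, by simp [hX], by simp⟩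
    | insert q s hq ih =>
      intro hs
      obtain ⟨Z, hZ⟩ := ih fun q hq => hs q (Finset.mem_insert_of_mem hq)
      have := hZ.pair (hs q (Finset.mem_insert_self _ _)) (m q.1 q.2) 1
      refine ⟨fun i => Z i + ((if i = q.1 then (m q.1 q.2).natAbs * 1 else 0) +
        (if i = q.2 then 1 else 0)), ?_⟩
      convert this using 2 with i i
      · ring
      · ext j
        by_cases e : (i, j) = q
        · subst e; simp [hq]
        · have e' : ¬ (i = q.1 ∧ j = q.2) := fun h => e (Prod.ext h.1 h.2)
          simp [e, e']
  obtain ⟨Z, v, h1, h2⟩ := key (Finset.univ.filter fun q => q.1 < q.2) (by simp)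
  refine ⟨Z, v, h1, fun i j hij => ?_⟩
  rw [h2 i j hij, hm i j hij]; simp [hij]

lemma exists_pair {K : ℕ} (a b : Fin K → ℚ) (p q : Fin 2 → ℚ)
    (hp : p ∈ coneGen (fun i => ![a i, b i])) (hq : q ∈ coneGen (fun i => ![a i, b i]))
    (h : LinearIndependent ℚ ![p, q]) : ∃ i j, i < j ∧ a i * b j - a j * b i ≠ 0 := by
  by_contra! H
  have H' : ∀ i j, a i * b j = a j * b i := by
    intro i j
    rcases lt_trichotomy i j with h | h | h
    · linarith [H i j h]
    · subst h; ring
    · linarith [H j i h]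
  obtain ⟨c, -, hc⟩ := hp
  obtain ⟨d, -, hd⟩ := hq
  have c0 : p 0 = ∑ i, c i * a i := by rw [hc]; simp
  have c1 : p 1 = ∑ i, c i * b i := by rw [hc]; simp
  have d0 : q 0 = ∑ i, d i * a i := by rw [hd]; simp
  have d1 : q 1 = ∑ i, d i * b i := by rw [hd]; simp
  have hdet : p 0 * q 1 = p 1 * q 0 := by
    rw [c0, c1, d0, d1, Finset.sum_mul_sum, Finset.sum_mul_sum]
    refine Finset.sum_congr rfl fun i _ => Finset.sum_congr rfl fun j _ => ?_
    linear_combination c i * d j * H' i j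
  rw [LinearIndependent.pair_iff] at h
  have s1 := h (q 1) (-p 1) (by ext i; fin_cases i <;> simp <;> linarith)
  have s0 := h (q 0) (-p 0) (by ext i; fin_cases i <;> simp <;> linarith)
  have := h 1 0 (by
    ext i; fin_cases i <;> simp
    · linarith [s0.2]
    · linarith [s1.2])
  exact one_ne_zero this.1

lemma pos_of_interior {K : ℕ} (u : Fin K → Fin 2 → ℚ) (r : Fin 2 → ℚ) (T : Set (Fin 2 → ℚ))
    (hT : T ⊆ coneGen u) (hr : r ∈ interior T) :
    ∃ c : Fin K → ℚ, (∀ i, 0 < c i) ∧ r = ∑ i, c i • u i := by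
  have hcont : Filter.Tendsto (fun e : ℚ => r - e • ∑ i, u i) (nhdsWithin 0 (Set.Ioi 0)) (nhds r) := by
    have : Continuous (fun e : ℚ => r - e • ∑ i, u i) := by fun_prop
    have h := this.tendsto 0
    simp only [zero_smul, sub_zero] at h
    exact h.mono_left nhdsWithin_le_nhds
  have h1 := hcont.eventually (isOpen_interior.mem_nhds hr)
  obtain ⟨e, he, he'⟩ := (h1.and self_mem_nhdsWithin).exists
  obtain ⟨c, hc, hce⟩ := hT (interior_subset he)
  refine ⟨fun i => c i + e, fun i => ?_, ?_⟩
  · have : (0:ℚ) < e := he'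
    linarith [hc i]
  · simp only [add_smul, Finset.sum_add_distrib, ← Finset.smul_sum, ← hce]
    simp

lemma clear_den {K : ℕ} (c : Fin K → ℚ) (hc : ∀ i, 0 < c i) :
    ∃ N : ℕ, 0 < N ∧ ∃ p : Fin K → ℕ, (∀ i, 0 < p i) ∧ ∀ i, (N : ℚ) * c i = p i := by
  refine ⟨∏ i, (c i).den, Finset.prod_pos fun i _ => (c i).den_pos, ?_⟩
  have : ∀ i, ∃ p : ℕ, 0 < p ∧ ((∏ i, (c i).den : ℕ) : ℚ) * c i = p := by
    intro i
    refine ⟨(∏ j ∈ Finset.univ.erase i, (c j).den) * (c i).num.toNat, ?_, ?_⟩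
    · refine Nat.mul_pos (Finset.prod_pos fun i _ => (c i).den_pos) ?_
      have := Rat.num_pos.mpr (hc i)
      omega
    · rw [← Finset.mul_prod_erase _ _ (Finset.mem_univ i)]
      have h1 : ((c i).num.toNat : ℚ) = (c i).num := by
        have := Rat.num_pos.mpr (hc i)
        exact_mod_cast Int.toNat_of_nonneg this.le
      have h2 := Rat.den_mul_eq_num (c i)
      push_cast
      rw [h1, ← h2]; ring
  choose p h1 h2 using this
  exact ⟨p, h1, h2⟩

end HeisAux

/-- Proposition 8: in the hard case where C_𝒢 ∩ C_ℋ is two-dimensional,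
⟨𝒢⟩ ∩ S⟨ℋ⟩ ≠ ∅ iff the relaxed system (1), (2) with parity constraints (3)
has an integer solution. -/
theorem stmt17 (K M : ℕ)
    (A : Fin K → Matrix (Fin 3) (Fin 3) ℚ) (B : Fin M → Matrix (Fin 3) (Fin 3) ℚ)
    (S : Matrix (Fin 3) (Fin 3) ℚ)
    (hA : ∀ i, IsUnitriangular (A i)) (hB : ∀ j, IsUnitriangular (B j))
    (hS : IsUnitriangular S)
    (hind : ∃ a ∈ coneGen (fun i => phi (mlog (A i))) ∩ coneGen (fun j => phi (mlog (B j))),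
            ∃ b ∈ coneGen (fun i => phi (mlog (A i))) ∩ coneGen (fun j => phi (mlog (B j))),
      LinearIndependent ℚ ![a, b])
    (hint : (interior (coneGen (fun i => phi (mlog (A i))) ∩
      coneGen (fun j => phi (mlog (B j))))).Nonempty) :
    (∃ v : List (Fin K), v ≠ [] ∧ ∃ w : List (Fin M), w ≠ [] ∧
        (v.map A).prod = S * (w.map B).prod) ↔
    (∃ (x : Fin K → ℕ) (y : Fin M → ℕ) (c : Fin K → Fin K → ℤ) (d : Fin M → Fin M → ℤ),
      (∑ i : Fin K, (x i : ℚ) • phi (mlog (A i))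
        = phi (mlog S) + ∑ j : Fin M, (y j : ℚ) • phi (mlog (B j))) ∧
      ((∑ i : Fin K, (x i : ℚ) * pi13 (mlog (A i)))
          + (1 / 2 : ℚ) * ∑ i : Fin K, ∑ j ∈ Finset.Ioi i,
              (c i j : ℚ) * pi13 (mcomm (mlog (A i)) (mlog (A j)))
        = pi13 (mlog S)
          + (∑ j : Fin M, (y j : ℚ) *
              (pi13 (mlog (B j)) + (1 / 2 : ℚ) * pi13 (mcomm (mlog S) (mlog (B j)))))
          + (1 / 2 : ℚ) * ∑ i : Fin M, ∑ j ∈ Finset.Ioi i,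
              (d i j : ℚ) * pi13 (mcomm (mlog (B i)) (mlog (B j)))) ∧
      (∀ i j : Fin K, i < j → c i j ≡ (x i : ℤ) * (x j : ℤ) [ZMOD 2]) ∧
      (∀ i j : Fin M, i < j → d i j ≡ (y i : ℤ) * (y j : ℤ) [ZMOD 2])) := by
  
  choose a b z hA' using fun i => HeisAux.exists_hm (hA i)
  choose a' b' z' hB' using fun i => HeisAux.exists_hm (hB i)
  obtain ⟨s, t, r, rfl⟩ := HeisAux.exists_hm hS
  obtain rfl : A = fun i => HeisAux.hm (a i) (b i) (z i) := funext hA'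
  obtain rfl : B = fun i => HeisAux.hm (a' i) (b' i) (z' i) := funext hB'
  clear hA hB hS hA' hB'
  simp only [HeisAux.phi_hm, HeisAux.pi_hm, HeisAux.comm_hm] at hind hint ⊢
  have hphi : ∀ (x : Fin K → ℕ) (y : Fin M → ℕ),
      (∑ i : Fin K, (x i : ℚ) • (![a i, b i] : Fin 2 → ℚ)
        = ![s, t] + ∑ j : Fin M, (y j : ℚ) • (![a' j, b' j] : Fin 2 → ℚ)) ↔
      (∑ i, (x i : ℚ) * a i = s + ∑ j, (y j : ℚ) * a' j) ∧
      (∑ i, (x i : ℚ) * b i = t + ∑ j, (y j : ℚ) * b' j) := by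
    intro x y
    rw [funext_iff, Fin.forall_fin_two]
    simp
  simp only [hphi, HeisAux.prod_hm, HeisAux.hm_mul]
  have hlin : ∀ (y : Fin M → ℚ), ∑ j, y j * (z' j + 1 / 2 * (s * b' j - a' j * t)) =
      ∑ j, y j * z' j + (s * (∑ j, y j * b' j) - (∑ j, y j * a' j) * t) / 2 := by
    intro y
    rw [Finset.mul_sum, Finset.sum_mul, ← Finset.sum_sub_distrib, Finset.sum_div,
      ← Finset.sum_add_distrib]
    exact Finset.sum_congr rfl fun j _ => by ring
  constructor
  · rintro ⟨v, -, w, -, h⟩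
    obtain ⟨e1, e2, e3⟩ := HeisAux.hm_inj h
    refine ⟨fun i => v.count i, fun j => w.count j, fun i j => HeisAux.sc i j v,
      fun i j => HeisAux.sc i j w, ⟨e1, e2⟩, ?_, fun i j hij => HeisAux.sc_parity hij.ne v,
      fun i j hij => HeisAux.sc_parity hij.ne w⟩
    rw [hlin, e3]; ring
  · rintro ⟨x, y, c, d, ⟨e1, e2⟩, e3, hc, hd⟩
    obtain ⟨f, ⟨hf, hf'⟩, g, ⟨hg, hg'⟩, hfg⟩ := hind
    obtain ⟨k, l, hkl, hω⟩ := HeisAux.exists_pair a b f g hf hg hfg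
    obtain ⟨k', -⟩ := HeisAux.exists_pair a' b' f g hf' hg' hfg
    obtain ⟨R, hR⟩ := hint
    obtain ⟨p₀, hp₀, hRp⟩ := HeisAux.pos_of_interior _ R _ Set.inter_subset_left hR
    obtain ⟨q₀, hq₀, hRq⟩ := HeisAux.pos_of_interior _ R _ Set.inter_subset_right hR
    obtain ⟨N₁, hN₁, p₁, hp₁, hNp⟩ := HeisAux.clear_den p₀ hp₀
    obtain ⟨N₂, hN₂, q₁, hq₁, hNq⟩ := HeisAux.clear_den q₀ hq₀
    obtain ⟨p, hp, hpa, hpb, q, hq, hqa, hqb⟩ : ∃ p : Fin K → ℕ, (∀ i, 0 < p i) ∧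
        (∑ i, (p i : ℚ) * a i = N₁ * N₂ * R 0) ∧ (∑ i, (p i : ℚ) * b i = N₁ * N₂ * R 1) ∧
        ∃ q : Fin M → ℕ, (∀ i, 0 < q i) ∧
        (∑ i, (q i : ℚ) * a' i = N₁ * N₂ * R 0) ∧ (∑ i, (q i : ℚ) * b' i = N₁ * N₂ * R 1) := by
      have c0 : R 0 = ∑ i, p₀ i * a i := by rw [hRp]; simp
      have c1 : R 1 = ∑ i, p₀ i * b i := by rw [hRp]; simp
      have d0 : R 0 = ∑ i, q₀ i * a' i := by rw [hRq]; simp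
      have d1 : R 1 = ∑ i, q₀ i * b' i := by rw [hRq]; simp
      refine ⟨fun i => N₂ * p₁ i, fun i => Nat.mul_pos hN₂ (hp₁ i), ?_, ?_,
        fun i => N₁ * q₁ i, fun i => Nat.mul_pos hN₁ (hq₁ i), ?_, ?_⟩
      · rw [c0, Finset.mul_sum]
        refine Finset.sum_congr rfl fun i _ => ?_
        push_cast; rw [← hNp]; ring
      · rw [c1, Finset.mul_sum]
        refine Finset.sum_congr rfl fun i _ => ?_
        push_cast; rw [← hNp]; ring
      · rw [d0, Finset.mul_sum]
        refine Finset.sum_congr rfl fun i _ => ?_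
        push_cast; rw [← hNq]; ring
      · rw [d1, Finset.mul_sum]
        refine Finset.sum_congr rfl fun i _ => ?_
        push_cast; rw [← hNq]; ring
    obtain ⟨Z, hZ⟩ := HeisAux.real_of_parity x c hc
    obtain ⟨W, hW⟩ := HeisAux.real_of_parity y d hd
    -- the residual and its integrality
    obtain ⟨L, m, hL, hres⟩ : ∃ (L : ℕ) (m : ℤ), 0 < L ∧
        2 * (L : ℚ) * (∑ i, (p i : ℚ) * z i) + m * (a k * b l - a l * b k)
          = 2 * (L : ℚ) * (∑ j, (q j : ℚ) * (z' j + 1 / 2 * (s * b' j - a' j * t))) := by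
      set P := ∑ i, (p i : ℚ) * z i
      set Q := ∑ j, (q j : ℚ) * (z' j + 1 / 2 * (s * b' j - a' j * t))
      set ω := a k * b l - a l * b k
      refine ⟨((Q - P) / ω).den, 2 * ((Q - P) / ω).num, Rat.den_pos _, ?_⟩
      have h := Rat.den_mul_eq_num ((Q - P) / ω)
      push_cast
      rw [← h]
      field_simp
      ring
    obtain ⟨n, hn1, hnZ, hnW⟩ : ∃ n : ℕ, 0 < n ∧ (∀ i, Z i + m.natAbs + 1 ≤ n) ∧
        ∀ j, W j ≤ n := by
      refine ⟨∑ i, Z i + ∑ j, W j + m.natAbs + 1, by omega, fun i => ?_, fun j => ?_⟩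
      · have := Finset.single_le_sum (f := Z) (fun _ _ => Nat.zero_le _) (Finset.mem_univ i)
        omega
      · have := Finset.single_le_sum (f := W) (fun _ _ => Nat.zero_le _) (Finset.mem_univ j)
        omega
    have hbig : ∀ e : ℕ, 0 < e → n * n ≤ L * n ^ 2 * e := by
      intro e he
      have : 1 ≤ L * e := Nat.mul_pos hL he
      calc n * n = 1 * (n * n) := by ring
        _ ≤ (L * e) * (n * n) := Nat.mul_le_mul_right _ this
        _ = _ := by ring
    have h1 : HeisAux.Rlz (fun i => x i + 2 * (L * n ^ 2 * p i))
        (fun i j => c i j + 2 * (if i = k ∧ j = l then m * (n : ℤ) ^ 2 else 0)) := by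
      have := (hZ.pair hkl m n).fill (fun i => L * n ^ 2 * p i - (Z i +
        ((if i = k then m.natAbs * n else 0) + (if i = l then n else 0))))
      convert this using 2 with i
      have hle : Z i + ((if i = k then m.natAbs * n else 0) + (if i = l then n else 0))
          ≤ L * n ^ 2 * p i := by
        refine le_trans ?_ (hbig _ (hp i))
        have h2 : (Z i + m.natAbs + 1) * n ≤ n * n := Nat.mul_le_mul_right _ (hnZ i)
        have h3 : Z i ≤ Z i * n := Nat.le_mul_of_pos_right _ hn1
        have h4 : (if i = k then m.natAbs * n else 0) ≤ m.natAbs * n := by split_ifs <;> simp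
        have h5 : (if i = l then n else 0) ≤ n := by split_ifs <;> simp
        nlinarith
      omega
    have h2 : HeisAux.Rlz (fun i => y i + 2 * (L * n ^ 2 * q i)) d := by
      have := hW.fill (fun i => L * n ^ 2 * q i - W i)
      convert this using 2 with i
      have hle : W i ≤ L * n ^ 2 * q i :=
        (hnW i).trans ((Nat.le_mul_of_pos_left _ hn1).trans (hbig _ (hq i)))
      omega
    obtain ⟨v, hv1, hv2⟩ := h1
    obtain ⟨w, hw1, hw2⟩ := h2
    refine ⟨v, ?_, w, ?_, ?_⟩
    · rintro rfl
      have h := hv1 k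
      have h' := hbig _ (hp k)
      have := Nat.mul_pos hn1 hn1
      simp only [List.count_nil] at h
      omega
    · rintro rfl
      have h := hw1 k'
      have h' := hbig _ (hq k')
      have := Nat.mul_pos hn1 hn1
      simp only [List.count_nil] at h
      omega
    · have sx : ∀ f : Fin K → ℚ, ∑ i, (v.count i : ℚ) * f i
          = ∑ i, (x i : ℚ) * f i + 2 * L * n ^ 2 * ∑ i, (p i : ℚ) * f i := by
        intro f
        rw [Finset.mul_sum, ← Finset.sum_add_distrib]
        refine Finset.sum_congr rfl fun i _ => ?_
        rw [hv1]; push_cast; ring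
      have sy : ∀ f : Fin M → ℚ, ∑ i, (w.count i : ℚ) * f i
          = ∑ i, (y i : ℚ) * f i + 2 * L * n ^ 2 * ∑ i, (q i : ℚ) * f i := by
        intro f
        rw [Finset.mul_sum, ← Finset.sum_add_distrib]
        refine Finset.sum_congr rfl fun i _ => ?_
        rw [hw1]; push_cast; ring
      have sv : ∑ i, ∑ j ∈ Finset.Ioi i, (HeisAux.sc i j v : ℚ) * (a i * b j - a j * b i)
          = ∑ i, ∑ j ∈ Finset.Ioi i, (c i j : ℚ) * (a i * b j - a j * b i)
            + 2 * m * n ^ 2 * (a k * b l - a l * b k) := by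
        have : ∑ i, ∑ j ∈ Finset.Ioi i, (if i = k ∧ j = l then
            2 * m * n ^ 2 * (a i * b j - a j * b i) else 0)
            = 2 * m * n ^ 2 * (a k * b l - a l * b k) := by
          rw [Finset.sum_eq_single k, Finset.sum_eq_single l]
          · simp
          · intro j _ hj; simp [hj]
          · intro h; exact absurd (Finset.mem_Ioi.mpr hkl) h
          · intro i _ hi; simp [hi]
          · simp
        rw [← this, ← Finset.sum_add_distrib]
        refine Finset.sum_congr rfl fun i _ => ?_
        rw [← Finset.sum_add_distrib]
        refine Finset.sum_congr rfl fun j hj => ?_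
        rw [hv2 i j (Finset.mem_Ioi.mp hj)]
        beta_reduce
        split_ifs <;> push_cast <;> ring
      have sw : ∑ i, ∑ j ∈ Finset.Ioi i, (HeisAux.sc i j w : ℚ) * (a' i * b' j - a' j * b' i)
          = ∑ i, ∑ j ∈ Finset.Ioi i, (d i j : ℚ) * (a' i * b' j - a' j * b' i) :=
        Finset.sum_congr rfl fun i _ => Finset.sum_congr rfl fun j hj => by
          rw [hw2 i j (Finset.mem_Ioi.mp hj)]
      rw [sv, sw, sx, sx, sx, sy, sy, sy]
      rw [hlin] at e3 hres
      congr 1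
      · rw [e1, hpa, hqa]; ring
      · rw [e2, hpb, hqb]; ring
      · linear_combination e3 + (n : ℚ) ^ 2 * hres
end
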